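/- arXiv:2502.05614 — 4 statements merged into one kernel-verified Lean document; each statement's English description precedes it below -/
import Mathlib

section
/- Let δ > 0 and let u : (0,∞) → ℂ be continuously differentiable, compactly supported in [0,∞), with lim_{r→0⁺} u(r) = 0. Then ∫₀^∞ (1+r)^{−3−δ}|u(r)|² dr ≤ ∫₀^∞ (1+r)^{−1−δ}|u'(r)|² dr. -/
open MeasureTheory Set Filter
open scoped ENNReal

/-- Bound on a truncated half-line. -/
theorem hwp_aux (δ : ℝ) (hδ : 0 < δ) (u u' : ℝ → ℂ)
    (hderiv : ∀ r : ℝ, 0 < r → HasDerivAt u (u' r) r)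
    (hcont : ContinuousOn u' (Ioi 0)) (R : ℝ)
    (hsupp : ∀ r : ℝ, R ≤ r → u r = 0) (e : ℝ) (he : 0 < e) (heR : e ≤ R) :
    ∫⁻ r in Ioi e, ENNReal.ofReal ((1 + r) ^ (-(3 + δ)) * ‖u r‖ ^ 2) ≤
      (∫⁻ r in Ioi (0 : ℝ), ENNReal.ofReal ((1 + r) ^ (-(1 + δ)) * ‖u' r‖ ^ 2))
        + ENNReal.ofReal (‖u e‖ ^ 2) := by
  have hpos : ∀ r ∈ Icc e R, 0 < r := fun r hr => he.trans_le hr.1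
  have hu : ContinuousOn u (Icc e R) := fun r hr =>
    (hderiv r (hpos r hr)).continuousAt.continuousWithinAt
  have hu' : ContinuousOn u' (Icc e R) := hcont.mono hpos
  have hw : ∀ p : ℝ, ContinuousOn (fun r : ℝ => (1 + r) ^ p) (Icc e R) := fun p =>
    ContinuousOn.rpow_const (by fun_prop) (fun r hr => Or.inl (by have := hpos r hr; linarith))
  have hA : ContinuousOn (fun r : ℝ => (1 + r) ^ (-(3 + δ)) * ‖u r‖ ^ 2) (Icc e R) :=
    (hw _).mul (hu.norm.pow 2)
  have hB : ContinuousOn (fun r : ℝ => (1 + r) ^ (-(1 + δ)) * ‖u' r‖ ^ 2) (Icc e R) :=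
    (hw _).mul (hu'.norm.pow 2)
  have hG : ContinuousOn (fun r : ℝ => -(2 + δ) * (1 + r) ^ (-(3 + δ)) * ‖u r‖ ^ 2
      + (1 + r) ^ (-(2 + δ)) * (2 * inner ℝ (u r) (u' r))) (Icc e R) :=
    ((continuousOn_const.mul (hw _)).mul (hu.norm.pow 2)).add
      ((hw _).mul (continuousOn_const.mul (hu.inner hu')))
  have hgd : ∀ r ∈ uIcc e R, HasDerivAt (fun r : ℝ => (1 + r) ^ (-(2 + δ)) * ‖u r‖ ^ 2)
      (-(2 + δ) * (1 + r) ^ (-(3 + δ)) * ‖u r‖ ^ 2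
      + (1 + r) ^ (-(2 + δ)) * (2 * inner ℝ (u r) (u' r))) r := by
    intro r hr
    rw [uIcc_of_le heR] at hr
    have h0 := hpos r hr
    have h1 : HasDerivAt (fun r : ℝ => (1 + r) ^ (-(2 + δ)))
        (-(2 + δ) * (1 + r) ^ (-(3 + δ))) r := by
      have := ((hasDerivAt_id r).const_add 1).rpow_const (p := -(2 + δ))
        (Or.inl (by simp; linarith))
      rw [show -(2 + δ) - 1 = -(3 + δ) by ring, one_mul] at this
      exact this
    exact h1.mul (hderiv r h0).norm_sq
  have hFTC := intervalIntegral.integral_eq_sub_of_hasDerivAt hgd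
    (hG.intervalIntegrable_of_Icc heR)
  have hAi := hA.intervalIntegrable_of_Icc (μ := volume) heR
  have hBi := hB.intervalIntegrable_of_Icc (μ := volume) heR
  have hGi := hG.intervalIntegrable_of_Icc (μ := volume) heR
  have key : ∫ r in e..R, ((1 + r) ^ (-(3 + δ)) * ‖u r‖ ^ 2) ≤
      (∫ r in e..R, ((1 + r) ^ (-(1 + δ)) * ‖u' r‖ ^ 2)) + ‖u e‖ ^ 2 := by
    have h2 := intervalIntegral.integral_mono_on heR (hAi.add hGi) hBi (by
      intro r hr
      have h0 := hpos r hr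
      have h1 : 0 < 1 + r := by linarith
      have e1 : (1 + r) ^ (-(2 + δ)) = (1 + r) ^ (-(3 + δ)) * (1 + r) := by
        rw [← Real.rpow_add_one h1.ne']; congr 1; ring
      have e2 : (1 + r) ^ (-(1 + δ)) = (1 + r) ^ (-(3 + δ)) * (1 + r) * (1 + r) := by
        rw [← e1, ← Real.rpow_add_one h1.ne']; congr 1; ring
      have hi := real_inner_le_norm (u r) (u' r)
      have hp : 0 < (1 + r) ^ (-(3 + δ)) := Real.rpow_pos_of_pos h1 _
      simp only [e1, e2]
      generalize (1 + r) ^ (-(3 + δ)) = p at *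
      have h3 : ‖u r‖ ^ 2 + (-(2 + δ) * ‖u r‖ ^ 2 + (1 + r) * (2 * inner ℝ (u r) (u' r)))
          ≤ (1 + r) * (1 + r) * ‖u' r‖ ^ 2 := by
        have := mul_le_mul_of_nonneg_left hi h1.le
        nlinarith [sq_nonneg (‖u r‖ - (1 + r) * ‖u' r‖), mul_nonneg hδ.le (sq_nonneg ‖u r‖)]
      have := mul_le_mul_of_nonneg_left h3 hp.le
      linarith)
    rw [intervalIntegral.integral_add hAi hGi, hFTC, hsupp R le_rfl] at h2
    have h4 : (1 + e) ^ (-(2 + δ)) ≤ 1 :=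
      Real.rpow_le_one_of_one_le_of_nonpos (by linarith) (by linarith)
    have := mul_le_mul_of_nonneg_right h4 (sq_nonneg ‖u e‖)
    simp at h2 this ⊢
    linarith
  have hnn : ∀ (p : ℝ) (v : ℝ → ℂ), 0 ≤ᵐ[volume.restrict (Ioc e R)]
      fun r : ℝ => (1 + r) ^ p * ‖v r‖ ^ 2 := by
    intro p v
    filter_upwards [ae_restrict_mem measurableSet_Ioc] with r hr
    have : 0 < 1 + r := by linarith [hr.1]
    simp only [Pi.zero_apply]
    positivity
  rw [intervalIntegral.integral_of_le heR, intervalIntegral.integral_of_le heR] at key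
  have hz : ∫⁻ r in Ioi R, ENNReal.ofReal ((1 + r) ^ (-(3 + δ)) * ‖u r‖ ^ 2) = 0 := by
    rw [setLIntegral_congr_fun (g := fun _ => 0) measurableSet_Ioi]
    · simp
    · intro r hr
      simp [hsupp r (le_of_lt hr)]
  calc _ ≤ (∫⁻ r in Ioc e R, ENNReal.ofReal ((1 + r) ^ (-(3 + δ)) * ‖u r‖ ^ 2)) + 0 := by
        rw [← Ioc_union_Ioi_eq_Ioi heR, ← hz]
        exact lintegral_union_le _ _ _
    _ = ENNReal.ofReal (∫ r in Ioc e R, ((1 + r) ^ (-(3 + δ)) * ‖u r‖ ^ 2)) := by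
        rw [add_zero, ofReal_integral_eq_lintegral_ofReal hAi.1 (hnn _ _)]
    _ ≤ ENNReal.ofReal ((∫ r in Ioc e R, ((1 + r) ^ (-(1 + δ)) * ‖u' r‖ ^ 2)) + ‖u e‖ ^ 2) :=
        ENNReal.ofReal_le_ofReal key
    _ ≤ _ := ENNReal.ofReal_add_le
    _ ≤ _ := by
        gcongr
        rw [ofReal_integral_eq_lintegral_ofReal hBi.1 (hnn _ _)]
        exact lintegral_mono_set (fun r hr => he.trans hr.1)



/-- Weighted Hardy–Poincaré inequality on the half-line:
`∫₀^∞ (1+r)^{-3-δ}|u|² dr ≤ ∫₀^∞ (1+r)^{-1-δ}|u'|² dr` for `C¹` functions compactly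
supported in `[0,∞)` with `u(0⁺) = 0`. -/
theorem halfline_weighted_poincare (δ : ℝ) (hδ : 0 < δ) (u u' : ℝ → ℂ)
    (hderiv : ∀ r : ℝ, 0 < r → HasDerivAt u (u' r) r)
    (hcont : ContinuousOn u' (Ioi 0))
    (hsupp : ∃ R : ℝ, ∀ r : ℝ, R ≤ r → u r = 0)
    (hlim : Tendsto u (nhdsWithin 0 (Ioi 0)) (nhds 0)) :
    ∫⁻ r in Ioi (0 : ℝ), ENNReal.ofReal ((1 + r) ^ (-(3 + δ)) * ‖u r‖ ^ 2) ≤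
      ∫⁻ r in Ioi (0 : ℝ), ENNReal.ofReal ((1 + r) ^ (-(1 + δ)) * ‖u' r‖ ^ 2) := by

  obtain ⟨R, hR⟩ := hsupp
  have hU : Ioi (0 : ℝ) = ⋃ n : ℕ, Ioi (1 / ((n : ℝ) + 1)) := by
    ext r
    simp only [mem_Ioi, mem_iUnion]
    refine ⟨fun h => exists_nat_one_div_lt h, fun ⟨n, hn⟩ => lt_trans (by positivity) hn⟩
  have hdir : Directed (· ⊆ ·) (fun n : ℕ => Ioi (1 / ((n : ℝ) + 1))) := by
    apply Monotone.directed_le (f := fun n : ℕ => Ioi (1 / ((n : ℝ) + 1)))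
    intro m n hmn
    exact Ioi_subset_Ioi (Nat.one_div_le_one_div hmn)
  have hT : Tendsto (fun e : ℝ =>
      (∫⁻ r in Ioi (0 : ℝ), ENNReal.ofReal ((1 + r) ^ (-(1 + δ)) * ‖u' r‖ ^ 2))
        + ENNReal.ofReal (‖u e‖ ^ 2)) (nhdsWithin 0 (Ioi 0))
      (nhds ((∫⁻ r in Ioi (0 : ℝ), ENNReal.ofReal ((1 + r) ^ (-(1 + δ)) * ‖u' r‖ ^ 2)) + 0)) := by
    refine tendsto_const_nhds.add ?_
    have := ENNReal.tendsto_ofReal (hlim.norm.pow 2)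
    simpa using this
  rw [add_zero] at hT
  have hb : ∀ n : ℕ, ∫⁻ r in Ioi (1 / ((n : ℝ) + 1)),
      ENNReal.ofReal ((1 + r) ^ (-(3 + δ)) * ‖u r‖ ^ 2) ≤
      ∫⁻ r in Ioi (0 : ℝ), ENNReal.ofReal ((1 + r) ^ (-(1 + δ)) * ‖u' r‖ ^ 2) := by
    intro n
    have hn : (0 : ℝ) < 1 / ((n : ℝ) + 1) := by positivity
    refine ge_of_tendsto hT ?_
    filter_upwards [Ioo_mem_nhdsGT hn] with e he
    exact (lintegral_mono_set (Ioi_subset_Ioi he.2.le)).trans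
      (hwp_aux δ hδ u u' hderiv hcont (max R e)
        (fun r hr => hR r ((le_max_left _ _).trans hr)) e he.1 (le_max_right _ _))
  calc _ = ∫⁻ r in ⋃ n : ℕ, Ioi (1 / ((n : ℝ) + 1)),
        ENNReal.ofReal ((1 + r) ^ (-(3 + δ)) * ‖u r‖ ^ 2) := by rw [← hU]
    _ = _ := setLIntegral_iUnion_of_directed _ hdir
    _ ≤ _ := iSup_le hb
end

section
/- Let n ≥ 1, let s, t ∈ ℝ, and let p > 0. Then the double integral ∫_{ℝⁿ}∫_{ℝⁿ} ⟨x⟩^{−s}⟨y⟩^{−t}|x−y|^{−p} dx dy is finite if and only if s + p > n, t + p > n, s + t + p > 2n, and p < n. -/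
open MeasureTheory Set
open scoped ENNReal

lemma wk_ball_iff (n : ℕ) (hn : 1 ≤ n) (a r : ℝ) (hr : 0 < r) :
    (∫⁻ x in Metric.ball (0 : EuclideanSpace ℝ (Fin n)) r, ENNReal.ofReal (‖x‖ ^ (-a))) < ⊤
      ↔ a < n := by
  have : Nonempty (Fin n) := ⟨⟨0, hn⟩⟩
  have h1 : IntegrableOn (fun x : EuclideanSpace ℝ (Fin n) => ‖x‖ ^ (-a)) (Metric.ball 0 r) volume
      ↔ a < n := by
    rw [integrableOn_fun_norm_addHaar volume (f := fun u : ℝ => u ^ (-a))]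
    rw [show (a < n ↔ -1 < ((n : ℝ) - 1) + (-a)) by constructor <;> intro h <;> linarith]
    rw [← intervalIntegral.integrableOn_Ioo_rpow_iff hr]
    apply integrableOn_congr_fun _ measurableSet_Ioo
    intro x hx
    simp only [finrank_euclideanSpace, Fintype.card_fin, smul_eq_mul]
    rw [Real.rpow_add hx.1, ← Real.rpow_natCast]
    push_cast [Nat.cast_sub hn]
    rfl
  rw [← h1, IntegrableOn, Integrable, hasFiniteIntegral_iff_ofReal
    (Filter.Eventually.of_forall fun x => by positivity)]
  refine ⟨fun h => ⟨?_, h⟩, fun h => h.2⟩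
  exact (by fun_prop : Measurable fun x : EuclideanSpace ℝ (Fin n) => ‖x‖ ^ (-a)).aestronglyMeasurable

lemma wk_compl_iff (n : ℕ) (hn : 1 ≤ n) (a r : ℝ) (hr : 0 < r) :
    (∫⁻ x in (Metric.ball (0 : EuclideanSpace ℝ (Fin n)) r)ᶜ, ENNReal.ofReal (‖x‖ ^ (-a))) < ⊤
      ↔ n < a := by
  have : Nonempty (Fin n) := ⟨⟨0, hn⟩⟩
  have h1 : IntegrableOn (fun x : EuclideanSpace ℝ (Fin n) => ‖x‖ ^ (-a)) (Metric.ball 0 r)ᶜ volume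
      ↔ n < a := by
    rw [← integrable_indicator_iff measurableSet_ball.compl]
    have : (Metric.ball (0 : EuclideanSpace ℝ (Fin n)) r)ᶜ.indicator (fun x => ‖x‖ ^ (-a)) =
      fun x => (Ici r).indicator (fun u : ℝ => u ^ (-a)) ‖x‖ := by
      ext x
      simp [indicator]
    rw [this, integrable_fun_norm_addHaar volume (f := (Ici r).indicator (fun u : ℝ => u ^ (-a)))]
    rw [show (n < a ↔ ((n : ℝ) - 1) + (-a) < -1) by constructor <;> intro h <;> linarith]
    rw [← integrableOn_Ioi_rpow_iff hr, ← integrable_indicator_iff (measurableSet_Ioi (a := 0)),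
      ← integrableOn_Ici_iff_integrableOn_Ioi, ← integrable_indicator_iff measurableSet_Ici]
    apply iff_of_eq
    congr 1
    ext x
    by_cases hx : r ≤ x
    · have hx0 : 0 < x := by linarith
      simp only [finrank_euclideanSpace, Fintype.card_fin, smul_eq_mul, indicator, mem_Ioi, mem_Ici, hx, hx0, if_true]
      rw [Real.rpow_add hx0, ← Real.rpow_natCast]
      push_cast [Nat.cast_sub hn]
      rfl
    · simp [indicator, hx]
  rw [← h1, IntegrableOn, Integrable, hasFiniteIntegral_iff_ofReal
    (Filter.Eventually.of_forall fun x => by positivity)]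
  refine ⟨fun h => ⟨?_, h⟩, fun h => h.2⟩
  exact (by fun_prop : Measurable fun x : EuclideanSpace ℝ (Fin n) => ‖x‖ ^ (-a)).aestronglyMeasurable

lemma wk_scale (n : ℕ) (r : ℝ) (hr : 0 < r) (f : EuclideanSpace ℝ (Fin n) → ℝ≥0∞)
    (hf : Measurable f) :
    ∫⁻ x, f x = ENNReal.ofReal (r ^ (n : ℝ)) * ∫⁻ x, f (r • x) := by
  have h := Measure.map_addHaar_smul (volume : Measure (EuclideanSpace ℝ (Fin n))) hr.ne'
  have h2 := lintegral_map (μ := volume) hf (measurable_const_smul r)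
  rw [h, lintegral_smul_measure] at h2
  rw [← h2]
  simp only [finrank_euclideanSpace, Fintype.card_fin, smul_eq_mul]
  rw [← mul_assoc, ← ENNReal.ofReal_mul (by positivity), Real.rpow_natCast, abs_of_pos (by positivity),
    mul_inv_cancel₀ (by positivity)]
  simp

lemma wk_ball_scale (n : ℕ) (a r : ℝ) (hr : 0 < r) :
    (∫⁻ x in Metric.ball (0 : EuclideanSpace ℝ (Fin n)) r, ENNReal.ofReal (‖x‖ ^ (-a)))
      = ENNReal.ofReal (r ^ (n - a)) *
      (∫⁻ x in Metric.ball (0 : EuclideanSpace ℝ (Fin n)) 1, ENNReal.ofReal (‖x‖ ^ (-a))) := by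
  have hm : Measurable fun x : EuclideanSpace ℝ (Fin n) => ENNReal.ofReal (‖x‖ ^ (-a)) := by fun_prop
  rw [← lintegral_indicator measurableSet_ball, ← lintegral_indicator measurableSet_ball,
    wk_scale n r hr _ (hm.indicator measurableSet_ball), sub_eq_add_neg, Real.rpow_add hr,
    ENNReal.ofReal_mul (by positivity), mul_assoc, 
    ← lintegral_const_mul _ (hm.indicator measurableSet_ball)]
  congr 2
  ext x
  have : ‖r • x‖ < r ↔ ‖x‖ < 1 := by
    rw [norm_smul, Real.norm_of_nonneg hr.le]
    exact mul_lt_iff_lt_one_right hr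
  by_cases h : ‖x‖ < 1
  · simp only [indicator, mem_ball_zero_iff, this, h, if_true]
    rw [← ENNReal.ofReal_mul (by positivity), norm_smul, Real.norm_of_nonneg hr.le,
      Real.mul_rpow hr.le (norm_nonneg _)]
  · simp only [indicator, mem_ball_zero_iff, this, h, if_false, mul_zero]

lemma wk_compl_scale (n : ℕ) (a r : ℝ) (hr : 0 < r) :
    (∫⁻ x in (Metric.ball (0 : EuclideanSpace ℝ (Fin n)) r)ᶜ, ENNReal.ofReal (‖x‖ ^ (-a)))
      = ENNReal.ofReal (r ^ (n - a)) *
      (∫⁻ x in (Metric.ball (0 : EuclideanSpace ℝ (Fin n)) 1)ᶜ, ENNReal.ofReal (‖x‖ ^ (-a))) := by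
  have hm : Measurable fun x : EuclideanSpace ℝ (Fin n) => ENNReal.ofReal (‖x‖ ^ (-a)) := by fun_prop
  rw [← lintegral_indicator measurableSet_ball.compl, ← lintegral_indicator measurableSet_ball.compl,
    wk_scale n r hr _ (hm.indicator measurableSet_ball.compl), sub_eq_add_neg, Real.rpow_add hr,
    ENNReal.ofReal_mul (by positivity), mul_assoc, 
    ← lintegral_const_mul _ (hm.indicator measurableSet_ball.compl)]
  congr 2
  ext x
  have : ‖r • x‖ < r ↔ ‖x‖ < 1 := by
    rw [norm_smul, Real.norm_of_nonneg hr.le]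
    exact mul_lt_iff_lt_one_right hr
  by_cases h : ‖x‖ < 1
  · simp only [indicator, mem_compl_iff, mem_ball_zero_iff, this, h, if_false, not_true, mul_zero]
  · simp only [indicator, mem_compl_iff, mem_ball_zero_iff, this, h, not_false_iff, if_true]
    rw [← ENNReal.ofReal_mul (by positivity), norm_smul, Real.norm_of_nonneg hr.le,
      Real.mul_rpow hr.le (norm_nonneg _)]

lemma wk_cmp {A B u v : ℝ} (e : ℝ) (hA : 0 < A) (hv : 0 < v) (h1 : A * v ≤ u) (h2 : u ≤ B * v) :
    min (A ^ e) (B ^ e) * v ^ e ≤ u ^ e := by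
  have hAB : A ≤ B := le_of_mul_le_mul_right (h1.trans h2) hv
  have hB : 0 < B := by linarith
  have hu : 0 < u := lt_of_lt_of_le (by positivity) h1
  rcases le_total 0 e with he | he
  · calc _ ≤ A ^ e * v ^ e := by gcongr; exact min_le_left _ _
      _ = (A * v) ^ e := (Real.mul_rpow hA.le hv.le).symm
      _ ≤ _ := Real.rpow_le_rpow (by positivity) h1 he
  · calc _ ≤ B ^ e * v ^ e := by gcongr; exact min_le_right _ _
      _ = (B * v) ^ e := (Real.mul_rpow hB.le hv.le).symm
      _ ≤ _ := Real.rpow_le_rpow_of_nonpos hu h2 he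

lemma wk_sq_rpow {v : ℝ} (e : ℝ) (hv : 0 ≤ v) : (v ^ 2) ^ (-e / 2) = v ^ (-e) := by
  rw [← Real.rpow_natCast, ← Real.rpow_mul hv]; congr 1; push_cast; ring

/-- The integrand. -/
noncomputable def wkF (n : ℕ) (s t p : ℝ) (x y : EuclideanSpace ℝ (Fin n)) : ℝ≥0∞ :=
  ENNReal.ofReal ((1 + ‖x‖ ^ 2) ^ (-s / 2) * (1 + ‖y‖ ^ 2) ^ (-t / 2) * ‖x - y‖ ^ (-p))

lemma wkF_meas (n : ℕ) (s t p : ℝ) : Measurable (Function.uncurry (wkF n s t p)) := by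
  unfold wkF Function.uncurry
  fun_prop

lemma wkF_meas_right (n : ℕ) (s t p : ℝ) (x : EuclideanSpace ℝ (Fin n)) :
    Measurable (wkF n s t p x) := by
  unfold wkF
  fun_prop

lemma wk_swap (n : ℕ) (s t p : ℝ) :
    ∫⁻ x, ∫⁻ y, wkF n s t p x y = ∫⁻ x, ∫⁻ y, wkF n t s p x y := by
  rw [lintegral_lintegral_swap (wkF_meas n s t p).aemeasurable]
  congr 1; ext x; congr 1; ext y
  unfold wkF
  rw [norm_sub_rev]; congr 1; ring

lemma wk_exists (n : ℕ) (s t p : ℝ) (h : ∫⁻ x, ∫⁻ y, wkF n s t p x y < ⊤) :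
    ∃ x, ∫⁻ y, wkF n s t p x y < ⊤ :=
  (ae_lt_top (wkF_meas n s t p).lintegral_prod_right' h.ne).exists

lemma wk_nec_p (n : ℕ) (hn : 1 ≤ n) (s t p : ℝ)
    (h : ∫⁻ x, ∫⁻ y, wkF n s t p x y < ⊤) : p < n := by
  obtain ⟨x, hx⟩ := wk_exists n s t p h
  rw [← wk_ball_iff n hn p 1 one_pos]
  set c : ℝ := (1 + ‖x‖ ^ 2) ^ (-s / 2) * min ((1:ℝ) ^ (-t / 2)) ((1 + (‖x‖ + 1) ^ 2) ^ (-t / 2))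
    with hc
  have hc0 : 0 < c := by positivity
  have hm : Measurable fun x : EuclideanSpace ℝ (Fin n) => ENNReal.ofReal (‖x‖ ^ (-p)) := by fun_prop
  have key : ENNReal.ofReal c * ∫⁻ z in Metric.ball (0 : EuclideanSpace ℝ (Fin n)) 1,
      ENNReal.ofReal (‖z‖ ^ (-p)) < ⊤ := by
    refine lt_of_le_of_lt ?_ hx
    rw [← lintegral_indicator measurableSet_ball,
      ← lintegral_const_mul _ (hm.indicator measurableSet_ball),
      ← lintegral_sub_left_eq_self _ x]
    apply lintegral_mono
    intro y
    by_cases hy : ‖x - y‖ < 1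
    · simp only [indicator, mem_ball_zero_iff, hy, if_true, wkF]
      rw [← ENNReal.ofReal_mul hc0.le]
      apply ENNReal.ofReal_le_ofReal
      have h1 : ‖y‖ ≤ ‖x‖ + 1 := by
        have := norm_sub_norm_le y x
        rw [norm_sub_rev] at this; linarith
      have := wk_cmp (A := 1) (B := 1 + (‖x‖ + 1) ^ 2) (u := 1 + ‖y‖ ^ 2) (v := 1) (-t / 2)
        one_pos one_pos (by nlinarith [norm_nonneg y]) (by nlinarith [norm_nonneg y])
      rw [show (1:ℝ) ^ (-t / 2) = 1 from Real.one_rpow _, mul_one] at this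
      rw [hc, show (1:ℝ) ^ (-t / 2) = 1 from Real.one_rpow _]
      gcongr
    · simp only [indicator, mem_ball_zero_iff, hy, if_false, mul_zero, zero_le]
  by_contra hcon
  rw [not_lt_top_iff.mp hcon, ENNReal.mul_top (by simpa using hc0)] at key
  exact lt_irrefl _ key

lemma wk_japanese {v : ℝ} (e : ℝ) (hv : 1 ≤ v) :
    min ((1:ℝ) ^ (-e / 2)) (2 ^ (-e / 2)) * v ^ (-e) ≤ (1 + v ^ 2) ^ (-e / 2) := by
  rw [← wk_sq_rpow e (by linarith : 0 ≤ v)]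
  exact wk_cmp _ one_pos (by positivity) (by nlinarith) (by nlinarith)

lemma wk_nec_t (n : ℕ) (hn : 1 ≤ n) (s t p : ℝ) (hp : 0 < p)
    (h : ∫⁻ x, ∫⁻ y, wkF n s t p x y < ⊤) : n < t + p := by
  obtain ⟨x, hx⟩ := wk_exists n s t p h
  have hR : 0 < ‖x‖ + 1 := by positivity
  rw [← wk_compl_iff n hn (t + p) _ hR]
  set c : ℝ := (1 + ‖x‖ ^ 2) ^ (-s / 2) * min ((1:ℝ) ^ (-t / 2)) (2 ^ (-t / 2)) * 2 ^ (-p)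
    with hc
  have hc0 : 0 < c := by positivity
  have hm : Measurable fun x : EuclideanSpace ℝ (Fin n) =>
    ENNReal.ofReal (‖x‖ ^ (-(t + p))) := by fun_prop
  have key : ENNReal.ofReal c * ∫⁻ z in (Metric.ball (0 : EuclideanSpace ℝ (Fin n)) (‖x‖ + 1))ᶜ,
      ENNReal.ofReal (‖z‖ ^ (-(t + p))) < ⊤ := by
    refine lt_of_le_of_lt ?_ hx
    rw [← lintegral_indicator measurableSet_ball.compl,
      ← lintegral_const_mul _ (hm.indicator measurableSet_ball.compl)]
    apply lintegral_mono
    intro y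
    by_cases hy : ‖y‖ < ‖x‖ + 1
    · simp only [indicator, mem_compl_iff, mem_ball_zero_iff, hy, not_true, if_false, mul_zero, zero_le]
    · simp only [indicator, mem_compl_iff, mem_ball_zero_iff, hy, not_false_iff, if_true, wkF]
      rw [← ENNReal.ofReal_mul hc0.le]
      apply ENNReal.ofReal_le_ofReal
      push Not at hy
      have hy0 : 0 < ‖y‖ := by linarith
      have h1 : 1 ≤ ‖y‖ := by linarith [norm_nonneg x]
      have h2 := wk_japanese t h1
      have h3 : ‖x - y‖ ≤ 2 * ‖y‖ := by linarith [norm_sub_le x y]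
      have h4 : 0 < ‖x - y‖ := by
        have := norm_sub_norm_le y x
        rw [norm_sub_rev] at this; linarith
      have h5 : 2 ^ (-p) * ‖y‖ ^ (-p) ≤ ‖x - y‖ ^ (-p) := by
        rw [← Real.mul_rpow (by norm_num) hy0.le]
        exact Real.rpow_le_rpow_of_nonpos h4 h3 (by linarith)
      calc c * ‖y‖ ^ (-(t + p)) = (1 + ‖x‖ ^ 2) ^ (-s / 2) *
            (min ((1:ℝ) ^ (-t / 2)) (2 ^ (-t / 2)) * ‖y‖ ^ (-t)) * (2 ^ (-p) * ‖y‖ ^ (-p)) := by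
            rw [neg_add, Real.rpow_add hy0, hc]; ring
        _ ≤ _ := by gcongr
  by_contra hcon
  rw [not_lt_top_iff.mp hcon, ENNReal.mul_top (by simpa using hc0)] at key
  exact lt_irrefl _ key

lemma wk_nec_st (n : ℕ) (hn : 1 ≤ n) (s t p : ℝ) (hp : 0 < p)
    (h : ∫⁻ x, ∫⁻ y, wkF n s t p x y < ⊤) : 2 * (n : ℝ) < s + t + p := by
  suffices hs : (n : ℝ) < s + t + p - n by linarith
  have : Nonempty (Fin n) := ⟨⟨0, hn⟩⟩
  rw [← wk_compl_iff n hn _ _ one_pos]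
  set c : ℝ := min ((1:ℝ) ^ (-s / 2)) (2 ^ (-s / 2)) * min ((1:ℝ) ^ (-t / 2)) (17 ^ (-t / 2)) * 3 ^ (-p)
    with hc
  have hc0 : 0 < c := by positivity
  set V := volume (Metric.ball (0 : EuclideanSpace ℝ (Fin n)) 1) with hV
  have hV0 : V ≠ 0 := (Metric.measure_ball_pos _ _ one_pos).ne'
  have hm : Measurable fun x : EuclideanSpace ℝ (Fin n) =>
    ENNReal.ofReal (‖x‖ ^ (-(s + t + p - n))) := by fun_prop
  have key : (ENNReal.ofReal c * V) * ∫⁻ z in (Metric.ball (0 : EuclideanSpace ℝ (Fin n)) 1)ᶜ,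
      ENNReal.ofReal (‖z‖ ^ (-(s + t + p - n))) < ⊤ := by
    refine lt_of_le_of_lt ?_ h
    rw [← lintegral_indicator measurableSet_ball.compl,
      ← lintegral_const_mul _ (hm.indicator measurableSet_ball.compl)]
    apply lintegral_mono
    intro x
    by_cases hx : ‖x‖ < 1
    · simp only [indicator, mem_compl_iff, mem_ball_zero_iff, hx, not_true, if_false, mul_zero, zero_le]
    · simp only [indicator, mem_compl_iff, mem_ball_zero_iff, hx, not_false_iff, if_true]
      push Not at hx
      have hx0 : 0 < ‖x‖ := by linarith
      calc ENNReal.ofReal c * V * ENNReal.ofReal (‖x‖ ^ (-(s + t + p - n)))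
          = ENNReal.ofReal (c * ‖x‖ ^ (-(s + t + p))) *
              volume (Metric.ball ((3:ℝ) • x) ‖x‖) := by
            rw [Measure.addHaar_ball_of_pos _ _ hx0, ← hV, finrank_euclideanSpace, Fintype.card_fin,
              ← mul_assoc, mul_right_comm, ← ENNReal.ofReal_mul hc0.le,
              ← ENNReal.ofReal_mul (by positivity), mul_assoc c, ← Real.rpow_natCast,
              ← Real.rpow_add hx0]
            congr 4; ring
        _ = ∫⁻ y in Metric.ball ((3:ℝ) • x) ‖x‖, ENNReal.ofReal (c * ‖x‖ ^ (-(s + t + p))) := by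
            rw [setLIntegral_const]
        _ ≤ ∫⁻ y in Metric.ball ((3:ℝ) • x) ‖x‖, wkF n s t p x y := by
            apply setLIntegral_mono (wkF_meas_right n s t p x)
            intro y hy
            rw [mem_ball_iff_norm] at hy
            apply ENNReal.ofReal_le_ofReal
            have e3 : ‖(3:ℝ) • x‖ = 3 * ‖x‖ := by rw [norm_smul]; norm_num
            have e2 : ‖(2:ℝ) • x‖ = 2 * ‖x‖ := by rw [norm_smul]; norm_num
            have y1 : ‖y‖ ≤ 4 * ‖x‖ := by
              have := norm_sub_norm_le y ((3:ℝ) • x); linarith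
            have y2 : 2 * ‖x‖ ≤ ‖y‖ := by
              have := norm_sub_norm_le ((3:ℝ) • x) y
              rw [norm_sub_rev] at this; linarith
            have y3 : ‖x - y‖ ≤ 3 * ‖x‖ := by
              have : x - y = -(y - (3:ℝ) • x) - (2:ℝ) • x := by module
              have h' := norm_sub_le (-(y - (3:ℝ) • x)) ((2:ℝ) • x)
              rw [← this, norm_neg] at h'; linarith
            have y4 : 0 < ‖x - y‖ := by
              have := norm_sub_norm_le y x
              rw [norm_sub_rev] at this; linarith
            have h1 := wk_japanese s hx
            have h2 : min ((1:ℝ) ^ (-t / 2)) (17 ^ (-t / 2)) * ‖x‖ ^ (-t) ≤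
                (1 + ‖y‖ ^ 2) ^ (-t / 2) := by
              rw [← wk_sq_rpow t (norm_nonneg x)]
              exact wk_cmp _ one_pos (by positivity) (by nlinarith) (by nlinarith)
            have h5 : 3 ^ (-p) * ‖x‖ ^ (-p) ≤ ‖x - y‖ ^ (-p) := by
              rw [← Real.mul_rpow (by norm_num) hx0.le]
              exact Real.rpow_le_rpow_of_nonpos y4 y3 (by linarith)
            calc c * ‖x‖ ^ (-(s + t + p)) = (min ((1:ℝ) ^ (-s / 2)) (2 ^ (-s / 2)) * ‖x‖ ^ (-s)) *
                (min ((1:ℝ) ^ (-t / 2)) (17 ^ (-t / 2)) * ‖x‖ ^ (-t)) * (3 ^ (-p) * ‖x‖ ^ (-p)) := by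
                  rw [neg_add, neg_add, Real.rpow_add hx0, Real.rpow_add hx0, hc]; ring
              _ ≤ _ := by gcongr
        _ ≤ _ := setLIntegral_le_lintegral _ _
  by_contra hcon
  rw [not_lt_top_iff.mp hcon, ENNReal.mul_top (mul_ne_zero (by simpa using hc0) hV0)] at key
  exact lt_irrefl _ key

/-- indicator kernels -/
noncomputable def wkG (n : ℕ) (a r : ℝ) : EuclideanSpace ℝ (Fin n) → ℝ≥0∞ :=
  (Metric.ball 0 r).indicator fun z => ENNReal.ofReal (‖z‖ ^ (-a))

noncomputable def wkH (n : ℕ) (a r : ℝ) : EuclideanSpace ℝ (Fin n) → ℝ≥0∞ :=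
  (Metric.ball 0 r)ᶜ.indicator fun z => ENNReal.ofReal (‖z‖ ^ (-a))

lemma wkG_meas (n : ℕ) (a r : ℝ) : Measurable (wkG n a r) :=
  Measurable.indicator (by fun_prop) measurableSet_ball

lemma wkH_meas (n : ℕ) (a r : ℝ) : Measurable (wkH n a r) :=
  Measurable.indicator (by fun_prop) measurableSet_ball.compl

lemma wkG_scale (n : ℕ) (a r : ℝ) (hr : 0 < r) :
    ∫⁻ z, wkG n a r z = ENNReal.ofReal (r ^ (n - a)) * ∫⁻ z, wkG n a 1 z := by
  unfold wkG
  rw [lintegral_indicator measurableSet_ball, lintegral_indicator measurableSet_ball,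
    wk_ball_scale n a r hr]

lemma wkH_scale (n : ℕ) (a r : ℝ) (hr : 0 < r) :
    ∫⁻ z, wkH n a r z = ENNReal.ofReal (r ^ (n - a)) * ∫⁻ z, wkH n a 1 z := by
  unfold wkH
  rw [lintegral_indicator measurableSet_ball.compl, lintegral_indicator measurableSet_ball.compl,
    wk_compl_scale n a r hr]

lemma wkG_fin (n : ℕ) (hn : 1 ≤ n) (a : ℝ) (ha : a < n) : ∫⁻ z, wkG n a 1 z < ⊤ := by
  unfold wkG
  rw [lintegral_indicator measurableSet_ball]
  exact (wk_ball_iff n hn a 1 one_pos).2 ha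

lemma wkH_fin (n : ℕ) (hn : 1 ≤ n) (a : ℝ) (ha : n < a) : ∫⁻ z, wkH n a 1 z < ⊤ := by
  unfold wkH
  rw [lintegral_indicator measurableSet_ball.compl]
  exact (wk_compl_iff n hn a 1 one_pos).2 ha

lemma wk_pt (n : ℕ) (t p r : ℝ) (ht : 0 < t) (hp : 0 < p) (hr : 0 < r)
    (x y : EuclideanSpace ℝ (Fin n)) (hx : ‖x‖ = 2 * r) :
    ENNReal.ofReal (‖y‖ ^ (-t) * ‖x - y‖ ^ (-p)) ≤
      ENNReal.ofReal (r ^ (-p)) * wkG n t r y + ENNReal.ofReal (r ^ (-t)) * wkG n p r (x - y)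
      + wkH n (t + p) r y + wkH n (t + p) r (x - y) := by
  have htri : 2 * r ≤ ‖y‖ + ‖x - y‖ := by
    have := norm_add_le y (x - y)
    rw [add_sub_cancel, hx] at this; exact this
  by_cases h1 : ‖y‖ < r
  · have e : wkG n t r y = ENNReal.ofReal (‖y‖ ^ (-t)) := by
      simp [wkG, indicator, h1]
    refine le_trans ?_ (le_trans le_self_add (le_trans le_self_add le_self_add))
    rw [e, ← ENNReal.ofReal_mul (by positivity), mul_comm]
    apply ENNReal.ofReal_le_ofReal
    gcongr ?_ * _
    exact Real.rpow_le_rpow_of_nonpos hr (by linarith) (by linarith)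
  by_cases h2 : ‖x - y‖ < r
  · have e : wkG n p r (x - y) = ENNReal.ofReal (‖x - y‖ ^ (-p)) := by
      simp [wkG, indicator, h2]
    refine le_trans ?_ (le_trans le_add_self (le_trans le_self_add le_self_add))
    rw [e, ← ENNReal.ofReal_mul (by positivity)]
    apply ENNReal.ofReal_le_ofReal
    gcongr ?_ * _
    exact Real.rpow_le_rpow_of_nonpos hr (by linarith) (by linarith)
  have e1 : wkH n (t + p) r y = ENNReal.ofReal (‖y‖ ^ (-(t + p))) := by
    simp [wkH, indicator, not_lt.mp h1]
  have e2 : wkH n (t + p) r (x - y) = ENNReal.ofReal (‖x - y‖ ^ (-(t + p))) := by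
    simp [wkH, indicator, not_lt.mp h2]
  push Not at h1 h2
  rcases le_total ‖y‖ ‖x - y‖ with h | h
  · refine le_trans ?_ (le_trans le_add_self le_self_add)
    rw [e1, neg_add, Real.rpow_add (by linarith)]
    apply ENNReal.ofReal_le_ofReal
    gcongr _ * ?_
    exact Real.rpow_le_rpow_of_nonpos (by linarith) h (by linarith)
  · refine le_trans ?_ le_add_self
    rw [e2, neg_add, Real.rpow_add (by linarith)]
    apply ENNReal.ofReal_le_ofReal
    gcongr ?_ * _
    exact Real.rpow_le_rpow_of_nonpos (by linarith) h (by linarith)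

lemma wk_inner (n : ℕ) (hn : 1 ≤ n) (t p : ℝ) (ht : 0 < t) (hp : 0 < p) (htn : t < n)
    (hpn : p < n) (htp : n < t + p) : ∃ C : ℝ≥0∞, C < ⊤ ∧
    ∀ x : EuclideanSpace ℝ (Fin n), x ≠ 0 →
      ∫⁻ y, ENNReal.ofReal (‖y‖ ^ (-t) * ‖x - y‖ ^ (-p)) ≤
        C * ENNReal.ofReal (‖x‖ ^ (-(t + p - n))) := by
  refine ⟨ENNReal.ofReal (2⁻¹ ^ (-(t + p - n))) * ((∫⁻ z, wkG n t 1 z) + (∫⁻ z, wkG n p 1 z)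
    + (∫⁻ z, wkH n (t + p) 1 z) + (∫⁻ z, wkH n (t + p) 1 z)), ?_, ?_⟩
  · have a1 := wkG_fin n hn t htn
    have a2 := wkG_fin n hn p hpn
    have a3 := wkH_fin n hn (t + p) htp
    refine ENNReal.mul_lt_top ENNReal.ofReal_lt_top ?_
    simp only [ENNReal.add_lt_top]
    exact ⟨⟨⟨a1, a2⟩, a3⟩, a3⟩
  · intro x hx
    have hx0 : 0 < ‖x‖ := norm_pos_iff.2 hx
    set r := 2⁻¹ * ‖x‖ with hrdef
    have hr : 0 < r := by positivity
    have mG := wkG_meas n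
    have mH := wkH_meas n
    have mt : Measurable fun y : EuclideanSpace ℝ (Fin n) => wkG n t r y := mG t r
    have mp : Measurable fun y : EuclideanSpace ℝ (Fin n) => wkG n p r (x - y) :=
      (mG p r).comp (by fun_prop)
    have mh : Measurable fun y : EuclideanSpace ℝ (Fin n) => wkH n (t + p) r y := mH _ r
    have mh' : Measurable fun y : EuclideanSpace ℝ (Fin n) => wkH n (t + p) r (x - y) :=
      (mH _ r).comp (by fun_prop)
    refine (lintegral_mono fun y => wk_pt n t p r ht hp hr x y (by rw [hrdef]; ring)).trans ?_
    rw [lintegral_add_right _ mh', lintegral_add_right _ mh, lintegral_add_right _ (mp.const_mul _),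
      lintegral_const_mul _ mt, lintegral_const_mul _ mp, lintegral_sub_left_eq_self _ x,
      lintegral_sub_left_eq_self _ x, wkG_scale n t r hr, wkG_scale n p r hr, wkH_scale n _ r hr,
      ← mul_assoc, ← mul_assoc, ← ENNReal.ofReal_mul (by positivity),
      ← ENNReal.ofReal_mul (by positivity), ← Real.rpow_add hr, ← Real.rpow_add hr]
    rw [show -p + (n - t) = -(t + p - n) by ring, show -t + (n - p) = -(t + p - n) by ring,
      show n - (t + p) = -(t + p - n) by ring, mul_right_comm, ← ENNReal.ofReal_mul (by positivity),
      ← Real.mul_rpow (by norm_num) hx0.le, ← hrdef, mul_add, mul_add, mul_add]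

lemma wk_suff (n : ℕ) (hn : 1 ≤ n) (s t p : ℝ) (hs : 0 < s) (ht : 0 < t) (hp : 0 < p) (htn : t < n)
    (hpn : p < n) (htp : n < t + p) (hst : 2 * (n : ℝ) < s + t + p) :
    ∫⁻ x, ∫⁻ y, wkF n s t p x y < ⊤ := by
  have : Nonempty (Fin n) := ⟨⟨0, hn⟩⟩
  obtain ⟨C, hC, hb⟩ := wk_inner n hn t p ht hp htn hpn htp
  have key : ∀ x : EuclideanSpace ℝ (Fin n), x ≠ 0 → ∫⁻ y, wkF n s t p x y ≤
      C * (wkG n (t + p - n) 1 x + wkH n (s + t + p - n) 1 x) := by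
    intro x hx
    have hx0 : 0 < ‖x‖ := norm_pos_iff.2 hx
    calc ∫⁻ y, wkF n s t p x y ≤ ∫⁻ y, ENNReal.ofReal ((1 + ‖x‖ ^ 2) ^ (-s / 2)) *
          ENNReal.ofReal (‖y‖ ^ (-t) * ‖x - y‖ ^ (-p)) := by
          apply lintegral_mono_ae
          filter_upwards [Measure.ae_ne volume (0 : EuclideanSpace ℝ (Fin n))] with y hy
          have hy0 : 0 < ‖y‖ := norm_pos_iff.2 hy
          rw [wkF, ← ENNReal.ofReal_mul (by positivity), mul_assoc]
          apply ENNReal.ofReal_le_ofReal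
          gcongr
          rw [← wk_sq_rpow t hy0.le]
          exact Real.rpow_le_rpow_of_nonpos (by positivity) (by linarith) (by linarith)
      _ = ENNReal.ofReal ((1 + ‖x‖ ^ 2) ^ (-s / 2)) *
          ∫⁻ y, ENNReal.ofReal (‖y‖ ^ (-t) * ‖x - y‖ ^ (-p)) :=
          lintegral_const_mul _ (by fun_prop)
      _ ≤ ENNReal.ofReal ((1 + ‖x‖ ^ 2) ^ (-s / 2)) *
          (C * ENNReal.ofReal (‖x‖ ^ (-(t + p - n)))) := by gcongr; exact hb x hx
      _ = C * ENNReal.ofReal ((1 + ‖x‖ ^ 2) ^ (-s / 2) * ‖x‖ ^ (-(t + p - n))) := by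
          rw [ENNReal.ofReal_mul (by positivity)]; ring
      _ ≤ _ := by
          gcongr
          by_cases h1 : ‖x‖ < 1
          · have e : wkG n (t + p - n) 1 x = ENNReal.ofReal (‖x‖ ^ (-(t + p - n))) := by
              simp [wkG, indicator, h1]
            refine le_trans ?_ le_self_add
            rw [e]
            apply ENNReal.ofReal_le_ofReal
            apply mul_le_of_le_one_left (by positivity)
            exact Real.rpow_le_one_of_one_le_of_nonpos (by nlinarith) (by linarith)
          · have e : wkH n (s + t + p - n) 1 x = ENNReal.ofReal (‖x‖ ^ (-(s + t + p - n))) := by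
              simp [wkH, indicator, not_lt.mp h1]
            refine le_trans ?_ le_add_self
            rw [e, show -(s + t + p - n) = -s + -(t + p - n) by ring, Real.rpow_add hx0]
            apply ENNReal.ofReal_le_ofReal
            gcongr
            rw [← wk_sq_rpow s hx0.le]
            exact Real.rpow_le_rpow_of_nonpos (by positivity) (by linarith) (by linarith)
  calc _ ≤ ∫⁻ x, C * (wkG n (t + p - n) 1 x + wkH n (s + t + p - n) 1 x) := by
        apply lintegral_mono_ae
        filter_upwards [Measure.ae_ne volume (0 : EuclideanSpace ℝ (Fin n))] with x hx
        exact key x hx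
    _ = C * ((∫⁻ x, wkG n (t + p - n) 1 x) + ∫⁻ x, wkH n (s + t + p - n) 1 x) := by
        rw [lintegral_const_mul _ (by exact (wkG_meas _ _ _).add (wkH_meas _ _ _)),
          lintegral_add_left (wkG_meas _ _ _)]
    _ < ⊤ := ENNReal.mul_lt_top hC (ENNReal.add_lt_top.2
        ⟨wkG_fin n hn _ (by linarith), wkH_fin n hn _ (by linarith)⟩)

/-- The double integral `∫∫ ⟨x⟩^{-s}⟨y⟩^{-t}|x-y|^{-p} dx dy` over `ℝⁿ × ℝⁿ`
is finite iff `s+p > n`, `t+p > n`, `s+t+p > 2n`, and `p < n`. -/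
theorem weighted_kernel_integrable_iff (n : ℕ) (hn : 1 ≤ n) (s t p : ℝ) (hp : 0 < p) :
    (∫⁻ x : EuclideanSpace ℝ (Fin n), ∫⁻ y : EuclideanSpace ℝ (Fin n),
        ENNReal.ofReal ((1 + ‖x‖ ^ 2) ^ (-s / 2) * (1 + ‖y‖ ^ 2) ^ (-t / 2) *
          ‖x - y‖ ^ (-p))) < ⊤ ↔
      ((n : ℝ) < s + p ∧ (n : ℝ) < t + p ∧ 2 * (n : ℝ) < s + t + p ∧ p < n) := by
  change (∫⁻ x, ∫⁻ y, wkF n s t p x y) < ⊤ ↔ _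
  constructor
  · intro h
    exact ⟨wk_nec_t n hn t s p hp (by rwa [wk_swap]), wk_nec_t n hn s t p hp h,
      wk_nec_st n hn s t p hp h, wk_nec_p n hn s t p h⟩
  · rintro ⟨h1, h2, h3, h4⟩
    obtain ⟨t', ht1, ht2⟩ : ∃ t', max ((n : ℝ) - p) (2 * n - s - p) < t' ∧ t' < min t n := by
      apply exists_between
      rw [max_lt_iff, lt_min_iff, lt_min_iff]
      refine ⟨⟨?_, ?_⟩, ?_, ?_⟩ <;> linarith
    rw [max_lt_iff] at ht1
    rw [lt_min_iff] at ht2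
    refine lt_of_le_of_lt ?_ (wk_suff n hn s t' p (by linarith) (by linarith) hp ht2.2 h4
      (by linarith) (by linarith))
    refine lintegral_mono fun x => lintegral_mono fun y => ?_
    apply ENNReal.ofReal_le_ofReal
    gcongr
    · nlinarith [sq_nonneg ‖y‖]
    · linarith
end

section
/- Let C_V > 0, 0 < δ < 1, and define w(r) = 1 − (C_V/(C_V+δ))(1+r)^{−δ} for r ≥ 0. Then: (a) w'(r) = δC_V(C_V+δ)^{−1}(1+r)^{−1−δ}, 0 < w(r) ≤ 1, and 2w(r)r^{−1} − w'(r) ≥ 0 for all r > 0; (b) if V : (0,∞) → [0,∞) has locally bounded variation with distributional derivative the locally finite Borel measure dV satisfying dV ≤ −C_V(r+1)^{−1}V dr as Borel measures on (0,∞), then w dV + w'V dr ≤ 0 in the sense of Borel measures on (0,∞). -/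
open MeasureTheory Set
open scoped ENNReal

theorem rw_rpow_bound (δ r : ℝ) (hδ0 : 0 < δ) (hr : 0 ≤ r) :
    (1 + r) ^ (-δ) * (1 + δ * (r / (1 + r))) ≤ 1 := by
  have h1 : 0 < 1 + r := by linarith
  have h2 : 1 - (1 + r)⁻¹ ≤ Real.log (1 + r) := Real.one_sub_inv_le_log_of_pos h1
  have h3 : r / (1 + r) = 1 - (1 + r)⁻¹ := by field_simp; ring
  have h4 : δ * (r / (1 + r)) ≤ Real.log (1 + r) * δ := by
    rw [h3, mul_comm]; exact mul_le_mul_of_nonneg_right h2 hδ0.le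
  have h5 := Real.add_one_le_exp (Real.log (1 + r) * δ)
  rw [← Real.rpow_def_of_pos h1] at h5
  have h6 : 0 < (1 + r) ^ (-δ) := Real.rpow_pos_of_pos h1 _
  calc (1 + r) ^ (-δ) * (1 + δ * (r / (1 + r))) ≤ (1 + r) ^ (-δ) * (1 + r) ^ δ :=
        mul_le_mul_of_nonneg_left (by linarith) h6.le
    _ = 1 := by rw [← Real.rpow_add h1]; simp

theorem rw_rpow_split (δ r : ℝ) (hr : 0 ≤ r) :
    (1 + r) ^ (-(1 + δ)) = (1 + r) ^ (-δ) / (1 + r) := by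
  have h1 : 0 < 1 + r := by linarith
  rw [show -(1 + δ) = -δ - 1 by ring, Real.rpow_sub h1, Real.rpow_one]

theorem rw_rpow_le_one (δ r : ℝ) (hδ0 : 0 < δ) (hr : 0 ≤ r) : (1 + r) ^ (-δ) ≤ 1 :=
  Real.rpow_le_one_of_one_le_of_nonpos (by linarith) (by linarith)

theorem rw_key (CV δ r : ℝ) (hCV : 0 < CV) (hδ0 : 0 < δ) (hr : 0 ≤ r) :
    δ * CV / (CV + δ) * (1 + r) ^ (-(1 + δ)) ≤
      CV / (r + 1) * (1 - CV / (CV + δ) * (1 + r) ^ (-δ)) := by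
  rw [rw_rpow_split δ r hr]
  have hx := rw_rpow_le_one δ r hδ0 hr
  set x := (1 + r) ^ (-δ)
  have h1 : 0 < 1 + r := by linarith
  have h2 : CV / (r + 1) * (1 - CV / (CV + δ) * x) - δ * CV / (CV + δ) * (x / (1 + r))
      = CV * (1 - x) / (1 + r) := by
    rw [add_comm r 1]; field_simp; ring
  have : 0 ≤ CV * (1 - x) / (1 + r) := by
    apply div_nonneg (mul_nonneg hCV.le (by linarith)) h1.le
  linarith

/-- Properties of the weight `w(r) = 1 - (C_V/(C_V+δ))(1+r)^{-δ}`: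
(a) its derivative formula, bounds `0 < w ≤ 1`, and `2w/r - w' ≥ 0`; (b) for a nonnegative
locally BV potential `V` on `(0,∞)` with distributional derivative `dV = μp - μn` satisfying
`dV ≤ -C_V(r+1)⁻¹V dr`, one has `w dV + w'V dr ≤ 0` as Borel measures on `(0,∞)`. -/
theorem repulsive_weight_properties (CV δ : ℝ) (hCV : 0 < CV) (hδ0 : 0 < δ) (hδ1 : δ < 1) :
    (∀ r : ℝ, 0 ≤ r →
      HasDerivAt (fun r : ℝ => 1 - CV / (CV + δ) * (1 + r) ^ (-δ))
        (δ * CV / (CV + δ) * (1 + r) ^ (-(1 + δ))) r ∧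
      0 < 1 - CV / (CV + δ) * (1 + r) ^ (-δ) ∧
      1 - CV / (CV + δ) * (1 + r) ^ (-δ) ≤ 1) ∧
    (∀ r : ℝ, 0 < r →
      0 ≤ 2 * (1 - CV / (CV + δ) * (1 + r) ^ (-δ)) / r -
        δ * CV / (CV + δ) * (1 + r) ^ (-(1 + δ))) ∧
    (∀ V : ℝ → ℝ, (∀ r, 0 ≤ V r) → LocallyBoundedVariationOn V (Ioi 0) →
      ∀ μp μn : Measure ℝ,
        (∀ a b : ℝ, 0 < a → μp (Icc a b) < ⊤ ∧ μn (Icc a b) < ⊤) →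
        (∀ a b : ℝ, 0 < a → a ≤ b →
          Function.rightLim V b - Function.rightLim V a =
            (μp (Ioc a b)).toReal - (μn (Ioc a b)).toReal) →
        (∀ B : Set ℝ, MeasurableSet B → (∃ a b : ℝ, 0 < a ∧ B ⊆ Icc a b) →
          (μp B).toReal - (μn B).toReal ≤ -CV * ∫ r in B, V r / (r + 1)) →
        ∀ B : Set ℝ, MeasurableSet B → (∃ a b : ℝ, 0 < a ∧ B ⊆ Icc a b) →
          (∫⁻ r in B, ENNReal.ofReal (1 - CV / (CV + δ) * (1 + r) ^ (-δ)) ∂μp).toReal -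
            (∫⁻ r in B, ENNReal.ofReal (1 - CV / (CV + δ) * (1 + r) ^ (-δ)) ∂μn).toReal +
            (∫ r in B, δ * CV / (CV + δ) * (1 + r) ^ (-(1 + δ)) * V r) ≤ 0) := by
  have hc0 : 0 < CV / (CV + δ) := by positivity
  have hc1 : CV / (CV + δ) < 1 := by rw [div_lt_one (by positivity)]; linarith
  have hw : ∀ r : ℝ, 0 ≤ r → 0 < 1 - CV / (CV + δ) * (1 + r) ^ (-δ) ∧
      1 - CV / (CV + δ) * (1 + r) ^ (-δ) ≤ 1 := by
    intro r hr
    have hx := rw_rpow_le_one δ r hδ0 hr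
    have hx0 : 0 < (1 + r) ^ (-δ) := Real.rpow_pos_of_pos (by linarith) _
    constructor
    · nlinarith
    · have := mul_pos hc0 hx0
      linarith
  refine ⟨fun r hr => ⟨?_, hw r hr⟩, ?_, ?_⟩
  · have h1 : HasDerivAt (fun r : ℝ => 1 + r) 1 r := (hasDerivAt_id r).const_add 1
    have h2 := ((h1.rpow_const (p := -δ) (Or.inl (by linarith))).const_mul
      (CV / (CV + δ))).const_sub 1
    refine h2.congr_deriv ?_
    rw [show -(1 + δ) = -δ - 1 by ring]
    ring
  · intro r hr
    have hb := rw_rpow_bound δ r hδ0 hr.le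
    obtain ⟨hw0, -⟩ := hw r hr.le
    rw [rw_rpow_split δ r hr.le]
    set x := (1 + r) ^ (-δ)
    have h1 : 0 < 1 + r := by linarith
    rw [sub_nonneg, le_div_iff₀ hr]
    have e : δ * CV / (CV + δ) * (x / (1 + r)) * r =
        CV / (CV + δ) * (x * (1 + δ * (r / (1 + r)))) - CV / (CV + δ) * x := by
      field_simp; ring
    rw [e]
    nlinarith
  · intro V hV hBV μp μn hfin _ hle B hB ⟨a, b, ha, hBab⟩
    have hVint : IntegrableOn V (Icc a b) := by
      obtain ⟨p, q, hp, hq, rfl⟩ := hBV.exists_monotoneOn_sub_monotoneOn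
      have hsub : Icc a b ⊆ Ioi 0 := fun x hx => lt_of_lt_of_le ha hx.1
      exact ((hp.mono hsub).integrableOn_isCompact isCompact_Icc).sub
        ((hq.mono hsub).integrableOn_isCompact isCompact_Icc)
    have hVB : IntegrableOn V B := hVint.mono_set hBab
    have hpos : ∀ r ∈ B, 0 < r := fun r hr => lt_of_lt_of_le ha (hBab hr).1
    have hgB : IntegrableOn (fun r => CV * (V r / (r + 1))) B := by
      apply Integrable.const_mul
      refine Integrable.mono hVB ?_ ?_
      · exact (hVB.aemeasurable.div (by fun_prop)).aestronglyMeasurable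
      · refine (ae_restrict_iff' hB).2 (Filter.Eventually.of_forall fun r hr => ?_)
        have := hpos r hr
        rw [norm_div]
        apply div_le_self (norm_nonneg _)
        rw [Real.norm_of_nonneg (by linarith)]; linarith
    set w : ℝ → ℝ := fun r => 1 - CV / (CV + δ) * (1 + r) ^ (-δ) with hwdef
    have hwm : Measurable w := by rw [hwdef]; fun_prop
    set f : ℝ → ℝ≥0∞ := fun r => ENNReal.ofReal (CV * (V r / (r + 1))) with hf
    have hfm : AEMeasurable f (volume.restrict B) := hgB.aemeasurable.ennreal_ofReal
    have hmeas : μp.restrict B + (volume.restrict B).withDensity f ≤ μn.restrict B := by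
      refine Measure.le_iff.2 fun s hs => ?_
      have hsB : MeasurableSet (s ∩ B) := hs.inter hB
      have hsab : s ∩ B ⊆ Icc a b := inter_subset_right.trans hBab
      rw [Measure.add_apply, Measure.restrict_apply hs, Measure.restrict_apply hs,
        withDensity_apply _ hs, Measure.restrict_restrict hs]
      have h := hle (s ∩ B) hsB ⟨a, b, ha, hsab⟩
      have hpf : μp (s ∩ B) ≠ ⊤ := ((measure_mono hsab).trans_lt (hfin a b ha).1).ne
      have hnf : μn (s ∩ B) ≠ ⊤ := ((measure_mono hsab).trans_lt (hfin a b ha).2).ne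
      rw [hf, ← ofReal_integral_eq_lintegral_ofReal (hgB.mono_set inter_subset_right) ?_,
        integral_const_mul]
      · have hI : 0 ≤ CV * ∫ r in s ∩ B, V r / (r + 1) := by
          apply mul_nonneg hCV.le
          apply setIntegral_nonneg hsB
          intro r hr
          have := hpos r hr.2
          exact div_nonneg (hV r) (by linarith)
        rw [← ENNReal.ofReal_toReal hpf, ← ENNReal.ofReal_toReal hnf,
          ← ENNReal.ofReal_add ENNReal.toReal_nonneg hI]
        apply ENNReal.ofReal_le_ofReal
        linarith
      · refine (ae_restrict_iff' hsB).2 (Filter.Eventually.of_forall fun r hr => ?_)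
        have := hpos r hr.2
        exact mul_nonneg hCV.le (div_nonneg (hV r) (by linarith))
    have hmain := lintegral_mono' hmeas (le_refl fun r => ENNReal.ofReal (w r))
    rw [lintegral_add_measure, lintegral_withDensity_eq_lintegral_mul₀ hfm
      hwm.ennreal_ofReal.aemeasurable] at hmain
    have hN : ∫⁻ r in B, ENNReal.ofReal (w r) ∂μn ≠ ⊤ := by
      have h1 : ∫⁻ r in B, ENNReal.ofReal (w r) ∂μn ≤ ∫⁻ r in B, 1 ∂μn := by
        refine setLIntegral_mono measurable_const fun r hr => ?_
        rw [← ENNReal.ofReal_one]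
        exact ENNReal.ofReal_le_ofReal (hw r (hpos r hr).le).2
      rw [setLIntegral_one] at h1
      exact (h1.trans_lt ((measure_mono hBab).trans_lt (hfin a b ha).2)).ne
    have hR : ∫⁻ r in B, ENNReal.ofReal (δ * CV / (CV + δ) * (1 + r) ^ (-(1 + δ)) * V r) ≤
        ∫⁻ r in B, (f * fun r => ENNReal.ofReal (w r)) r := by
      refine setLIntegral_mono' hB fun r hr => ?_
      have hr0 := hpos r hr
      have hg0 : 0 ≤ CV * (V r / (r + 1)) :=
        mul_nonneg hCV.le (div_nonneg (hV r) (by linarith))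
      rw [Pi.mul_apply, hf, ← ENNReal.ofReal_mul hg0]
      apply ENNReal.ofReal_le_ofReal
      have := mul_le_mul_of_nonneg_right (rw_key CV δ r hCV hδ0 hr0.le) (hV r)
      refine this.trans (le_of_eq ?_)
      simp only [hwdef]
      ring
    have hI : ∫ r in B, δ * CV / (CV + δ) * (1 + r) ^ (-(1 + δ)) * V r =
        (∫⁻ r in B, ENNReal.ofReal
          (δ * CV / (CV + δ) * (1 + r) ^ (-(1 + δ)) * V r)).toReal := by
      refine integral_eq_lintegral_of_nonneg_ae ?_ ?_
      · refine (ae_restrict_iff' hB).2 (Filter.Eventually.of_forall fun r hr => ?_)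
        have hr0 := hpos r hr
        have : 0 < (1 + r) ^ (-(1 + δ)) := Real.rpow_pos_of_pos (by linarith) _
        have h2 := hV r
        simp only [Pi.zero_apply]
        positivity
      · exact (AEMeasurable.mul (by fun_prop) hVB.aemeasurable).aestronglyMeasurable
    rw [hI]
    have htot := (add_le_add_right hR (∫⁻ r in B, ENNReal.ofReal (w r) ∂μp)).trans hmain
    have h3 := ENNReal.toReal_mono hN htot
    have hsum := ne_top_of_le_ne_top hN htot
    rw [ENNReal.toReal_add (ENNReal.add_ne_top.1 hsum).1 (ENNReal.add_ne_top.1 hsum).2] at h3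
    linarith
end

section
/- Let s₁, s₂ > 1/2. For ε > 0 let T_ε be the integral operator on L²(ℝ³) with kernel K_ε(x,y) = ⟨x⟩^{−s₁}(4π|x−y|)^{−1}e^{−ε|x−y|}⟨y⟩^{−s₂}. If sup_{0<ε≤1} ‖T_ε‖_{L²(ℝ³)→L²(ℝ³)} < ∞, then s₁ + s₂ ≥ 2. -/
open MeasureTheory Set Real
open scoped ENNReal

/-- Sharpness: if the integral operators on `L²(ℝ³)` with kernels
`⟨x⟩^{-s₁}(4π|x-y|)⁻¹ e^{-ε|x-y|} ⟨y⟩^{-s₂}` are bounded uniformly in `0 < ε ≤ 1`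
(expressed via the associated bilinear forms on nonnegative functions), then `s₁ + s₂ ≥ 2`. -/
theorem low_freq_sharpness (s₁ s₂ : ℝ) (h₁ : 1 / 2 < s₁) (h₂ : 1 / 2 < s₂) (M : ℝ)
    (hM : ∀ ε : ℝ, 0 < ε → ε ≤ 1 →
      ∀ f g : EuclideanSpace ℝ (Fin 3) → ℝ≥0∞, Measurable f → Measurable g →
        (∫⁻ x : EuclideanSpace ℝ (Fin 3), ∫⁻ y : EuclideanSpace ℝ (Fin 3),
            ENNReal.ofReal ((1 + ‖x‖ ^ 2) ^ (-s₁ / 2) * (4 * π * ‖x - y‖)⁻¹ *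
              Real.exp (-ε * ‖x - y‖) * (1 + ‖y‖ ^ 2) ^ (-s₂ / 2)) * f y * g x) ≤
          ENNReal.ofReal M * (∫⁻ y, (f y) ^ 2) ^ ((1 : ℝ) / 2) *
            (∫⁻ x, (g x) ^ 2) ^ ((1 : ℝ) / 2)) :
    2 ≤ s₁ + s₂ := by
  by_contra hlt
  push Not at hlt
  set E := EuclideanSpace ℝ (Fin 3)
  set s := s₁ + s₂ with hs
  have hcpos : 0 < volume (Metric.ball (0 : E) 1) := Metric.measure_ball_pos _ _ one_pos
  have hcfin : volume (Metric.ball (0 : E) 1) ≠ ⊤ := measure_ball_lt_top.ne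
  set c : ℝ := (volume (Metric.ball (0 : E) 1)).toReal with hc
  have hc0 : 0 < c := ENNReal.toReal_pos hcpos.ne' hcfin
  have key : ∀ R : ℝ, 1 ≤ R →
      (1 + R ^ 2) ^ (-s / 2) * (4 * π * (2 * R))⁻¹ * Real.exp (-2) * (R ^ 3 * c) ≤ max M 0 := by
    intro R hR
    have hR0 : 0 < R := by linarith
    set k : ℝ := (1 + R ^ 2) ^ (-s / 2) * (4 * π * (2 * R))⁻¹ * Real.exp (-2) with hk
    have hk0 : 0 < k := by positivity
    set B : Set E := Metric.ball 0 R with hB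
    have hBm : MeasurableSet B := measurableSet_ball
    have hV : volume B = ENNReal.ofReal (R ^ 3 * c) := by
      rw [hB, Measure.addHaar_ball _ _ hR0.le, ENNReal.ofReal_mul (by positivity), hc,
        ENNReal.ofReal_toReal hcfin]
      simp [E]
    set f : E → ℝ≥0∞ := B.indicator 1 with hf
    have hfm : Measurable f := measurable_one.indicator hBm
    have h := hM (1 / R) (by positivity) (by rw [div_le_one hR0]; exact hR) f f hfm hfm
    have hf2 : ∫⁻ y, (f y) ^ 2 = volume B := by
      rw [← lintegral_indicator_one hBm]
      apply lintegral_congr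
      intro y
      by_cases hy : y ∈ B <;> simp [hf, hy]
    have hf1 : ∫⁻ y, f y = volume B := lintegral_indicator_one hBm
    have hlow : ENNReal.ofReal k * volume B * volume B ≤
        ∫⁻ x : E, ∫⁻ y : E,
            ENNReal.ofReal ((1 + ‖x‖ ^ 2) ^ (-s₁ / 2) * (4 * π * ‖x - y‖)⁻¹ *
              Real.exp (-(1 / R) * ‖x - y‖) * (1 + ‖y‖ ^ 2) ^ (-s₂ / 2)) * f y * f x := by
      calc ENNReal.ofReal k * volume B * volume B
          = ∫⁻ x : E, ∫⁻ y : E, ENNReal.ofReal k * f y * f x := by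
            have : ∀ x : E, ∫⁻ y : E, ENNReal.ofReal k * f y * f x
                = ENNReal.ofReal k * volume B * f x := by
              intro x
              rw [lintegral_mul_const _ (hfm.const_mul _), lintegral_const_mul _ hfm, hf1]
            simp_rw [this]
            rw [lintegral_const_mul _ hfm, hf1]
        _ ≤ _ := by
            apply lintegral_mono
            intro x
            apply lintegral_mono_ae
            have hne : ∀ᵐ y : E, y ≠ x := by
              simp [ae_iff]
            filter_upwards [hne] with y hyx
            by_cases hx : x ∈ B
            swap
            · simp [hf, hx]
            by_cases hy : y ∈ B
            swap
            · simp [hf, hy]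
            gcongr
            have hx' : ‖x‖ < R := by simpa [hB] using hx
            have hy' : ‖y‖ < R := by simpa [hB] using hy
            have hd : ‖x - y‖ ≤ 2 * R := by
              have := norm_sub_le x y
              linarith
            have hd0 : 0 < ‖x - y‖ := norm_pos_iff.2 (sub_ne_zero.2 (Ne.symm hyx))
            have e1 : (1 + R ^ 2) ^ (-s₁ / 2) ≤ (1 + ‖x‖ ^ 2) ^ (-s₁ / 2) := by
              apply Real.rpow_le_rpow_of_nonpos (by positivity) (by gcongr) (by linarith)
            have e2 : (1 + R ^ 2) ^ (-s₂ / 2) ≤ (1 + ‖y‖ ^ 2) ^ (-s₂ / 2) := by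
              apply Real.rpow_le_rpow_of_nonpos (by positivity) (by gcongr) (by linarith)
            have e3 : (4 * π * (2 * R))⁻¹ ≤ (4 * π * ‖x - y‖)⁻¹ := by gcongr
            have e4 : Real.exp (-2) ≤ Real.exp (-(1 / R) * ‖x - y‖) := by
              apply Real.exp_le_exp.2
              have : (1 / R) * ‖x - y‖ ≤ (1 / R) * (2 * R) := by gcongr
              have h2 : (1 / R) * (2 * R) = 2 := by field_simp
              linarith
            have hsplit : (1 + R ^ 2) ^ (-s / 2)
                = (1 + R ^ 2) ^ (-s₁ / 2) * (1 + R ^ 2) ^ (-s₂ / 2) := by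
              rw [← Real.rpow_add (by positivity)]
              congr 1
              rw [hs]; ring
            calc k = (1 + R ^ 2) ^ (-s₁ / 2) * (4 * π * (2 * R))⁻¹ * Real.exp (-2)
                  * (1 + R ^ 2) ^ (-s₂ / 2) := by rw [hk, hsplit]; ring
              _ ≤ _ := by gcongr
    have h' := hlow.trans h
    have hV0 : volume B ≠ 0 := (Metric.measure_ball_pos _ _ hR0).ne'
    have hVt : volume B ≠ ⊤ := measure_ball_lt_top.ne
    rw [hf2, mul_assoc (ENNReal.ofReal M), ← ENNReal.rpow_add _ _ hV0 hVt] at h'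
    norm_num at h'
    rw [ENNReal.mul_le_mul_iff_left hV0 hVt, hV, ← ENNReal.ofReal_mul hk0.le] at h'
    have h3 : ENNReal.ofReal M = ENNReal.ofReal (max M 0) := by simp [ENNReal.ofReal_max]
    rw [h3] at h'
    exact (ENNReal.ofReal_le_ofReal_iff (le_max_right _ _)).1 h'
  set C : ℝ := 2 ^ (-s / 2) * (8 * π)⁻¹ * Real.exp (-2) * c with hC
  have hC0 : 0 < C := by positivity
  have key2 : ∀ R : ℝ, 1 ≤ R → C * R ^ (2 - s) ≤ max M 0 := by
    intro R hR
    have hR0 : 0 < R := by linarith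
    refine le_trans ?_ (key R hR)
    have e : (2 * R ^ 2) ^ (-s / 2) ≤ (1 + R ^ 2) ^ (-s / 2) := by
      apply Real.rpow_le_rpow_of_nonpos (by positivity) (by nlinarith) (by linarith)
    have e2 : (2 * R ^ 2) ^ (-s / 2) = 2 ^ (-s / 2) * R ^ (-s) := by
      rw [Real.mul_rpow (by norm_num) (by positivity), ← Real.rpow_natCast R 2,
        ← Real.rpow_mul hR0.le]
      congr 2
      push_cast; ring
    have e3 : R ^ (2 - s) = R ^ 2 * R ^ (-s) := by
      rw [← Real.rpow_natCast R 2, ← Real.rpow_add hR0]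
      congr 1
    calc C * R ^ (2 - s) = (2 * R ^ 2) ^ (-s / 2) * (4 * π * (2 * R))⁻¹ * Real.exp (-2)
          * (R ^ 3 * c) := by
            rw [e2, e3, hC]
            field_simp
            ring
      _ ≤ _ := by gcongr
  have ht : Filter.Tendsto (fun R : ℝ => C * R ^ (2 - s)) Filter.atTop Filter.atTop :=
    (tendsto_rpow_atTop (by linarith)).const_mul_atTop hC0
  obtain ⟨R, hR1, hR2⟩ :=
    ((ht.eventually_gt_atTop (max M 0)).and (Filter.eventually_ge_atTop 1)).exists
  exact absurd (key2 R hR2) (not_le.2 hR1)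
end
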